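/- Let C > 0 and 0 < α < 1 be given. If max{2M, N}(1+C) · sup_{t∈ℝ} ∫_{−∞}^{∞} |𝒢(t,s)| ε(s)^α σ(s,t)^α ds ≤ C, then the map h from the conjugacy H(t,x,y) = (x + h(t,x,y), y) satisfies |h(t,x,y₁) − h(t,x,y₂)| ≤ C |y₁ − y₂|^α for all t ∈ ℝ, x ∈ X and y₁, y₂ ∈ Y. -/

import Mathlib

open MeasureTheory

/-- The Green function `𝒢(t,s)`. -/
noncomputable def Green {X : Type*} [NormedAddCommGroup X] [NormedSpace ℝ X]
    (T : ℝ → ℝ → X →L[ℝ] X) (P : ℝ → X →L[ℝ] X) (t s : ℝ) : X →L[ℝ] X :=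
  if s ≤ t then (T t s).comp (P s)
  else -((T t s).comp (ContinuousLinearMap.id ℝ X - P s))

/-- `T` is the evolution family of `ẋ = A(t)x`. -/
def IsEvolutionFamily {X : Type*} [NormedAddCommGroup X] [NormedSpace ℝ X]
    (A : ℝ → X →L[ℝ] X) (T : ℝ → ℝ → X →L[ℝ] X) : Prop :=
  (∀ s ξ t, HasDerivAt (fun r => T r s ξ) (A t (T t s ξ)) t) ∧
  (∀ s, T s s = ContinuousLinearMap.id ℝ X) ∧
  (∀ t r s, (T t r).comp (T r s) = T t s)

/-- An evolution family of a norm-continuous generator is norm-continuous in its first argument. -/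
theorem IsEvolutionFamily.continuous_left {X : Type*} [NormedAddCommGroup X] [NormedSpace ℝ X]
    [CompleteSpace X] {A : ℝ → X →L[ℝ] X} {T : ℝ → ℝ → X →L[ℝ] X}
    (hT : IsEvolutionFamily A T) (hA : Continuous A) (s : ℝ) : Continuous fun r => T r s := by
  rw [continuous_iff_continuousAt]
  intro r₀
  set I : Set ℝ := Set.Icc (r₀ - 1) (r₀ + 1) with hI
  have hIc : IsCompact I := isCompact_Icc
  have hr₀ : r₀ ∈ I := ⟨by linarith, by linarith⟩
  obtain ⟨a, ha⟩ := hIc.exists_bound_of_continuousOn hA.continuousOn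
  have hTc : ∀ ξ, Continuous fun r => T r s ξ := fun ξ =>
    continuous_iff_continuousAt.2 fun r => (hT.1 s ξ r).continuousAt
  obtain ⟨b, hb⟩ := banach_steinhaus (g := fun r : I => T r s) fun ξ => by
    obtain ⟨c, hc⟩ := hIc.exists_bound_of_continuousOn (hTc ξ).continuousOn
    exact ⟨c, fun r => hc r r.2⟩
  have ha0 : 0 ≤ a := (norm_nonneg _).trans (ha r₀ hr₀)
  have hb0 : 0 ≤ b := (norm_nonneg _).trans (hb ⟨r₀, hr₀⟩)
  have hlip : ∀ r ∈ I, ‖T r s - T r₀ s‖ ≤ a * b * ‖r - r₀‖ := by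
    intro r hr
    refine ContinuousLinearMap.opNorm_le_bound _ (by positivity) fun ξ => ?_
    have hmv := (convex_Icc (r₀ - 1) (r₀ + 1)).norm_image_sub_le_of_norm_hasDerivWithin_le
      (f := fun r => T r s ξ) (f' := fun r => A r (T r s ξ)) (C := a * (b * ‖ξ‖))
      (fun u _ => (hT.1 s ξ u).hasDerivWithinAt) (fun u hu =>
        (A u).le_of_opNorm_le_of_le (ha u hu) ((T u s).le_of_opNorm_le (hb ⟨u, hu⟩) ξ)) hr₀ hr
    calc ‖(T r s - T r₀ s) ξ‖ ≤ a * (b * ‖ξ‖) * ‖r - r₀‖ := hmv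
      _ = a * b * ‖r - r₀‖ * ‖ξ‖ := by ring
  rw [ContinuousAt, tendsto_iff_norm_sub_tendsto_zero]
  refine squeeze_zero' (g := fun r => a * b * ‖r - r₀‖)
    (Filter.Eventually.of_forall fun _ => norm_nonneg _) ?_ ?_
  · filter_upwards [Icc_mem_nhds (show r₀ - 1 < r₀ by linarith) (show r₀ < r₀ + 1 by linarith)]
      with r hr using hlip r hr
  · have hcont : Continuous fun r : ℝ => a * b * ‖r - r₀‖ := by fun_prop
    simpa using hcont.tendsto r₀

/-- An evolution family of a norm-continuous generator is norm-continuous in its second argument. -/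
theorem IsEvolutionFamily.continuous_right {X : Type*} [NormedAddCommGroup X] [NormedSpace ℝ X]
    [CompleteSpace X] {A : ℝ → X →L[ℝ] X} {T : ℝ → ℝ → X →L[ℝ] X}
    (hT : IsEvolutionFamily A T) (hA : Continuous A) (t : ℝ) : Continuous fun s => T t s := by
  have hmul : ∀ u v, T u v * T v u = 1 := fun u v => by
    rw [ContinuousLinearMap.mul_def, hT.2.2, hT.2.1]; rfl
  let U : ℝ → (X →L[ℝ] X)ˣ := fun s => ⟨T s t, T t s, hmul s t, hmul t s⟩
  have hinv : (fun s => T t s) = fun s => Ring.inverse (T s t) := by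
    funext s
    exact (Ring.inverse_unit (U s)).symm
  rw [hinv, continuous_iff_continuousAt]
  intro s
  exact ContinuousAt.comp (g := Ring.inverse) (f := fun s => T s t)
    (NormedRing.inverse_continuousAt (U s)) (hT.continuous_left hA t).continuousAt

theorem stronglyMeasurable_green {X : Type*} [NormedAddCommGroup X] [NormedSpace ℝ X]
    [CompleteSpace X] {A : ℝ → X →L[ℝ] X} {T : ℝ → ℝ → X →L[ℝ] X}
    (hT : IsEvolutionFamily A T) (hA : Continuous A) {P : ℝ → X →L[ℝ] X}
    (hP : StronglyMeasurable P) (t : ℝ) : StronglyMeasurable (Green T P t) := by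
  have hTm : StronglyMeasurable fun s => T t s := (hT.continuous_right hA t).stronglyMeasurable
  have hcomp : Continuous fun p : (X →L[ℝ] X) × (X →L[ℝ] X) => p.1.comp p.2 :=
    continuous_fst.clm_comp continuous_snd
  exact StronglyMeasurable.ite measurableSet_Iic
    (hcomp.comp_stronglyMeasurable (hTm.prodMk hP))
    (hcomp.comp_stronglyMeasurable (hTm.prodMk (stronglyMeasurable_const.sub hP))).neg

/-- A vector bounded by `2M` and by `e (C d ^ α + R + d)` has a bound that is Hölder in `e d`,
up to the error `e R`. -/
theorem le_holder_add_of_le_of_le {M N C α e d R v : ℝ} (hM : 1 ≤ M) (hN : 1 ≤ N) (hC : 0 < C)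
    (hα0 : 0 < α) (hα1 : α < 1) (he : 0 < e) (heN : e ≤ N) (hd : 0 ≤ d) (hR : 0 ≤ R)
    (hv : v ≤ 2 * M) (hv' : v ≤ e * (C * d ^ α + R + d)) :
    v ≤ max (2 * M) N * (1 + C) * (e ^ α * d ^ α) + e * R := by
  have hmul : (e * d) ^ α = e ^ α * d ^ α := Real.mul_rpow he.le hd
  have hpos : 0 ≤ e ^ α * d ^ α := by positivity
  have hm : 2 * M ≤ max (2 * M) N := le_max_left _ _
  have hn : N ≤ max (2 * M) N := le_max_right _ _
  rcases le_total (e * d) 1 with hed | hed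
  · have hlin : e * d ≤ e ^ α * d ^ α := by
      rw [← hmul]
      exact Real.self_le_rpow_of_le_one (by positivity) hed hα1.le
    have heα : e ≤ N * e ^ α := by
      have h1 : e ^ (1 - α) ≤ N := calc
        e ^ (1 - α) ≤ N ^ (1 - α) := Real.rpow_le_rpow he.le heN (by linarith)
        _ ≤ N := Real.rpow_le_self_of_one_le hN (by linarith)
      calc e = e ^ (1 - α) * e ^ α := by rw [← Real.rpow_add he]; simp
        _ ≤ N * e ^ α := by gcongr
    have hhol : e * (C * d ^ α) ≤ N * C * (e ^ α * d ^ α) := calc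
      e * (C * d ^ α) ≤ N * e ^ α * (C * d ^ α) := by gcongr
      _ = N * C * (e ^ α * d ^ α) := by ring
    calc v ≤ e * (C * d ^ α) + e * d + e * R := by linarith
      _ ≤ N * C * (e ^ α * d ^ α) + N * (e ^ α * d ^ α) + e * R := by
        have := le_mul_of_one_le_left hpos hN
        linarith
      _ = N * (1 + C) * (e ^ α * d ^ α) + e * R := by ring
      _ ≤ _ := by gcongr
  · have hone : 1 ≤ e ^ α * d ^ α := by
      rw [← hmul]
      exact Real.one_le_rpow hed hα0.le
    calc v ≤ 2 * M := hv
      _ ≤ max (2 * M) N * 1 * 1 + 0 := by simp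
      _ ≤ max (2 * M) N * (1 + C) * (e ^ α * d ^ α) + e * R := by
        gcongr
        · linarith
        · positivity

theorem holder_continuity_h_in_y
    {X Y : Type*} [NormedAddCommGroup X] [NormedSpace ℝ X] [CompleteSpace X]
    [NormedAddCommGroup Y] [NormedSpace ℝ Y] [CompleteSpace Y]
    (A : ℝ → X →L[ℝ] X) (hA : Continuous A)
    (T : ℝ → ℝ → X →L[ℝ] X) (hT : IsEvolutionFamily A T)
    (f : ℝ → X → Y → X) (hf : Continuous fun p : ℝ × X × Y => f p.1 p.2.1 p.2.2)
    (g : ℝ → Y → Y) (hg : Continuous fun p : ℝ × Y => g p.1 p.2)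
    -- `Φ` is the flow of `ẏ = g(t,y)`; solutions are global and unique
    (Φ : ℝ → ℝ → Y → Y)
    (hΦ : ∀ (τ : ℝ) (η : Y),
      (∀ t, HasDerivAt (fun r => Φ r τ η) (g t (Φ t τ η)) t) ∧ Φ τ τ η = η)
    (hgU : ∀ y w : ℝ → Y, (∀ t, HasDerivAt y (g t (y t)) t) →
      (∀ t, HasDerivAt w (g t (w t)) t) → ∀ τ, y τ = w τ → y = w)
    (P : ℝ → X →L[ℝ] X) (hP : StronglyMeasurable P)
    -- the bound `σ` on differences of solutions of `ẏ = g(t,y)`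
    (σ : ℝ → ℝ → ℝ) (hσc : Continuous fun p : ℝ × ℝ => σ p.1 p.2)
    (hσpos : ∀ t s, 0 < σ t s)
    (hσ : ∀ (y w : ℝ → Y), (∀ t, HasDerivAt y (g t (y t)) t) →
      (∀ t, HasDerivAt w (g t (w t)) t) →
      ∀ t s, ‖y t - w t‖ ≤ σ t s * ‖y s - w s‖)
    -- bounds on `f`
    (M N : ℝ) (hM : 1 ≤ M) (hN : 1 ≤ N)
    (ε : ℝ → ℝ) (hεc : Continuous ε) (hεpos : ∀ t, 0 < ε t) (hεN : ∀ t, ε t ≤ N)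
    (hfb : ∀ t x y, ‖f t x y‖ ≤ M)
    (hfl : ∀ (t : ℝ) (x₁ x₂ : X) (y₁ y₂ : Y),
      ‖f t x₁ y₁ - f t x₂ y₂‖ ≤ ε t * (‖x₁ - x₂‖ + ‖y₁ - y₂‖))
    -- integral conditions
    (K q : ℝ)
    (hKint : ∀ t, Integrable fun s => ‖Green T P t s‖)
    (hK : ∀ t, (∫ s, ‖Green T P t s‖) ≤ K)
    (hqint : ∀ t, Integrable fun s => ‖Green T P t s‖ * ε s)
    (hq : ∀ t, (∫ s, ‖Green T P t s‖ * ε s) ≤ q)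
    (hq1 : q < 1)
    -- `h` is the conjugacy: the bounded continuous fixed point of the operator `T`
    (h : ℝ → X → Y → X)
    (hhc : Continuous fun p : ℝ × X × Y => h p.1 p.2.1 p.2.2)
    (hhb : ∃ B : ℝ, ∀ t x y, ‖h t x y‖ ≤ B)
    (hfix : ∀ (τ : ℝ) (ξ : X) (η : Y), h τ ξ η =
      ∫ s, Green T P τ s (f s (T s τ ξ + h s (T s τ ξ) (Φ s τ η)) (Φ s τ η)))
    -- the Hölder data
    (C α : ℝ) (hC : 0 < C) (hα0 : 0 < α) (hα1 : α < 1)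
    (hint : ∀ t, Integrable fun s => ‖Green T P t s‖ * ε s ^ α * σ s t ^ α)
    (hcond : ∀ t, max (2 * M) N * (1 + C) *
      (∫ s, ‖Green T P t s‖ * ε s ^ α * σ s t ^ α) ≤ C) :
    ∀ (t : ℝ) (x : X) (y₁ y₂ : Y), ‖h t x y₁ - h t x y₂‖ ≤ C * ‖y₁ - y₂‖ ^ α := by
  obtain ⟨B, hB⟩ := hhb
  have hB0 : 0 ≤ B := (norm_nonneg _).trans (hB 0 0 0)
  have hq0 : 0 ≤ q :=
    (integral_nonneg fun s => mul_nonneg (norm_nonneg _) (hεpos s).le).trans (hq 0)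
  have hFc : ∀ (τ : ℝ) (ξ : X) (η : Y),
      Continuous fun s => f s (T s τ ξ + h s (T s τ ξ) (Φ s τ η)) (Φ s τ η) := by
    intro τ ξ η
    have hTc : Continuous fun s => T s τ ξ :=
      continuous_iff_continuousAt.2 fun r => (hT.1 τ ξ r).continuousAt
    have hΦc : Continuous fun s => Φ s τ η :=
      continuous_iff_continuousAt.2 fun r => ((hΦ τ η).1 r).continuousAt
    have hhc' : Continuous fun s => h s (T s τ ξ) (Φ s τ η) :=
      hhc.comp (continuous_id.prodMk (hTc.prodMk hΦc))
    exact hf.comp (continuous_id.prodMk ((hTc.add hhc').prodMk hΦc))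
  have hFint : ∀ (τ : ℝ) (ξ : X) (η : Y), Integrable fun s =>
      Green T P τ s (f s (T s τ ξ + h s (T s τ ξ) (Φ s τ η)) (Φ s τ η)) := by
    intro τ ξ η
    have happ : Continuous fun p : (X →L[ℝ] X) × X => p.1 p.2 :=
      continuous_fst.clm_apply continuous_snd
    refine ((hKint τ).mul_const M).mono' (happ.comp_stronglyMeasurable
      ((stronglyMeasurable_green hT hA hP τ).prodMk
        (hFc τ ξ η).stronglyMeasurable)).aestronglyMeasurable ?_
    exact Filter.Eventually.of_forall fun s =>
      (Green T P τ s).le_opNorm_of_le (hfb _ _ _)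
  have step : ∀ R, 0 ≤ R →
      (∀ t x y₁ y₂, ‖h t x y₁ - h t x y₂‖ ≤ C * ‖y₁ - y₂‖ ^ α + R) →
      ∀ t x y₁ y₂, ‖h t x y₁ - h t x y₂‖ ≤ C * ‖y₁ - y₂‖ ^ α + R * q := by
    intro R hR hh t x y₁ y₂
    set m := max (2 * M) N * (1 + C) with hm
    have hm0 : 0 ≤ m := by
      have : 0 ≤ max (2 * M) N := le_max_of_le_right (by linarith)
      positivity
    have hpt : ∀ s, ‖Green T P t s (f s (T s t x + h s (T s t x) (Φ s t y₁)) (Φ s t y₁))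
        - Green T P t s (f s (T s t x + h s (T s t x) (Φ s t y₂)) (Φ s t y₂))‖
        ≤ m * ‖y₁ - y₂‖ ^ α * (‖Green T P t s‖ * ε s ^ α * σ s t ^ α)
          + R * (‖Green T P t s‖ * ε s) := by
      intro s
      have hflow : ‖Φ s t y₁ - Φ s t y₂‖ ≤ σ s t * ‖y₁ - y₂‖ := by
        have := hσ (fun r => Φ r t y₁) (fun r => Φ r t y₂) (hΦ t y₁).1 (hΦ t y₂).1 s t
        simpa only [(hΦ t y₁).2, (hΦ t y₂).2] using this
      have hf1 := (norm_sub_le (f s (T s t x + h s (T s t x) (Φ s t y₁)) (Φ s t y₁))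
        (f s (T s t x + h s (T s t x) (Φ s t y₂)) (Φ s t y₂))).trans
          (add_le_add (hfb _ _ _) (hfb _ _ _))
      have hf2 := hfl s (T s t x + h s (T s t x) (Φ s t y₁))
        (T s t x + h s (T s t x) (Φ s t y₂)) (Φ s t y₁) (Φ s t y₂)
      rw [add_sub_add_left_eq_sub] at hf2
      have hf3 := hf2.trans (mul_le_mul_of_nonneg_left
        (add_le_add_left (hh s (T s t x) (Φ s t y₁) (Φ s t y₂)) _) (hεpos s).le)
      have hf4 := le_holder_add_of_le_of_le hM hN hC hα0 hα1 (hεpos s) (hεN s) (norm_nonneg _) hR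
        (hf1.trans_eq (by ring)) hf3
      have hσα : ‖Φ s t y₁ - Φ s t y₂‖ ^ α ≤ σ s t ^ α * ‖y₁ - y₂‖ ^ α := by
        rw [← Real.mul_rpow (hσpos s t).le (norm_nonneg _)]
        exact Real.rpow_le_rpow (norm_nonneg _) hflow hα0.le
      have hε0 : 0 ≤ ε s ^ α := Real.rpow_nonneg (hεpos s).le _
      rw [← map_sub]
      calc _ ≤ ‖Green T P t s‖ * (m * (ε s ^ α * ‖Φ s t y₁ - Φ s t y₂‖ ^ α) + ε s * R) :=
            (Green T P t s).le_opNorm_of_le hf4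
        _ ≤ ‖Green T P t s‖ * (m * (ε s ^ α * (σ s t ^ α * ‖y₁ - y₂‖ ^ α)) + ε s * R) := by
            gcongr
        _ = _ := by ring
    have hi₁ := (hint t).const_mul (m * ‖y₁ - y₂‖ ^ α)
    have hi₂ := (hqint t).const_mul R
    rw [hfix t x y₁, hfix t x y₂, ← integral_sub (hFint t x y₁) (hFint t x y₂)]
    refine (norm_integral_le_of_norm_le (hi₁.add hi₂) (Filter.Eventually.of_forall hpt)).trans ?_
    simp only [Pi.add_apply]
    rw [integral_add hi₁ hi₂, integral_const_mul, integral_const_mul]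
    refine add_le_add ?_ (mul_le_mul_of_nonneg_left (hq t) hR)
    calc _ = m * (∫ s, ‖Green T P t s‖ * ε s ^ α * σ s t ^ α) * ‖y₁ - y₂‖ ^ α := by ring
      _ ≤ C * ‖y₁ - y₂‖ ^ α :=
        mul_le_mul_of_nonneg_right (hcond t) (Real.rpow_nonneg (norm_nonneg _) _)
  have iter : ∀ n : ℕ, ∀ t x y₁ y₂,
      ‖h t x y₁ - h t x y₂‖ ≤ C * ‖y₁ - y₂‖ ^ α + 2 * B * q ^ n := by
    intro n
    induction n with
    | zero =>
      intro t x y₁ y₂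
      have h1 : ‖h t x y₁ - h t x y₂‖ ≤ B + B := norm_sub_le_of_le (hB _ _ _) (hB _ _ _)
      have h2 : 0 ≤ C * ‖y₁ - y₂‖ ^ α := by positivity
      linarith
    | succ n ih =>
      simpa only [pow_succ, mul_assoc] using step (2 * B * q ^ n) (by positivity) ih
  intro t x y₁ y₂
  have hlim : Filter.Tendsto (fun n : ℕ => C * ‖y₁ - y₂‖ ^ α + 2 * B * q ^ n) Filter.atTop
      (nhds (C * ‖y₁ - y₂‖ ^ α)) := by
    simpa using ((tendsto_pow_atTop_nhds_zero_of_lt_one hq0 hq1).const_mul (2 * B)).const_add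
      (C * ‖y₁ - y₂‖ ^ α)
  exact ge_of_tendsto' hlim fun n => iter n t x y₁ y₂
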